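/- Let G be a spray on a nonempty open set U ⊆ ℝ^n with n ≥ 3 and dV a volume form on U. Then the Berwald–Weyl curvature of (G,dV) satisfies W^o_k = (1/(n−2)) W^m_{k∥m}, where W^i_k is the Weyl curvature of G and the horizontal covariant derivative '∥' is taken with respect to the projective spray Ĝ of (G,dV). -/

import Mathlib

open scoped BigOperators
open MeasureTheory

noncomputable section BerwaldWeyl

/-- Points/vectors in local coordinates on `ℝⁿ`. -/
abbrev Vec (n : ℕ) := Fin n → ℝ

/-- Partial derivative in the base (`x`) variable along the `i`-th coordinate. -/
def pdx {n : ℕ} (f : Vec n → Vec n → ℝ) (i : Fin n) : Vec n → Vec n → ℝ :=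
  fun x y => fderiv ℝ (fun x' => f x' y) x (Pi.single i 1)

/-- Vertical derivative `f_{·i} = ∂f/∂y^i`. -/
def pdy {n : ℕ} (f : Vec n → Vec n → ℝ) (i : Fin n) : Vec n → Vec n → ℝ :=
  fun x y => fderiv ℝ (fun y' => f x y') y (Pi.single i 1)

/-- The slit fiber `ℝⁿ \ {0}`. -/
def slit (n : ℕ) : Set (Vec n) := {y | y ≠ 0}

/-- A spray on `U ⊆ ℝⁿ`: a family `G^i(x,y)`, smooth on `U × (ℝⁿ \ {0})` and
positively 2-homogeneous in `y`. -/
def IsSpray {n : ℕ} (U : Set (Vec n)) (G : Fin n → Vec n → Vec n → ℝ) : Prop :=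
  (∀ i, ContDiffOn ℝ (⊤ : ℕ∞) (fun p : Vec n × Vec n => G i p.1 p.2) (U ×ˢ slit n)) ∧
  (∀ i, ∀ x ∈ U, ∀ y ∈ slit n, ∀ c : ℝ, 0 < c → G i x (c • y) = c ^ 2 * G i x y)

/-- Nonlinear connection coefficients `N^i_j := ∂G^i/∂y^j`. -/
def Nc {n : ℕ} (G : Fin n → Vec n → Vec n → ℝ) (i j : Fin n) : Vec n → Vec n → ℝ :=
  pdy (G i) j

/-- Berwald connection coefficients `Γ^i_{jk} := ∂²G^i/∂y^j∂y^k`. -/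
def Γc {n : ℕ} (G : Fin n → Vec n → Vec n → ℝ) (i j k : Fin n) : Vec n → Vec n → ℝ :=
  pdy (pdy (G i) j) k

/-- Horizontal derivative of a scalar: `f_{|k} := δf/δx^k = ∂f/∂x^k - N^l_k ∂f/∂y^l`. -/
def hD {n : ℕ} (G : Fin n → Vec n → Vec n → ℝ) (f : Vec n → Vec n → ℝ) (k : Fin n) :
    Vec n → Vec n → ℝ :=
  fun x y => pdx f k x y - ∑ l, Nc G l k x y * pdy f l x y

/-- Horizontal covariant derivative `A_{j|m}` of a 1-form `A_j`. -/
def covD1 {n : ℕ} (G : Fin n → Vec n → Vec n → ℝ) (A : Fin n → Vec n → Vec n → ℝ)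
    (j m : Fin n) : Vec n → Vec n → ℝ :=
  fun x y => hD G (A j) m x y - ∑ l, A l x y * Γc G l j m x y

/-- Horizontal covariant derivative `A^i_{j|m}` of a (1,1)-tensor `A^i_j`. -/
def covD11 {n : ℕ} (G : Fin n → Vec n → Vec n → ℝ)
    (A : Fin n → Fin n → Vec n → Vec n → ℝ) (i j m : Fin n) : Vec n → Vec n → ℝ :=
  fun x y => hD G (A i j) m x y + ∑ l, A l j x y * Γc G i l m x y
    - ∑ l, A i l x y * Γc G l j m x y

/-- Horizontal covariant derivative `B^i_{jk|m}` of a (1,2)-tensor `B^i_{jk}`. -/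
def covD12 {n : ℕ} (G : Fin n → Vec n → Vec n → ℝ)
    (B : Fin n → Fin n → Fin n → Vec n → Vec n → ℝ) (i j k m : Fin n) : Vec n → Vec n → ℝ :=
  fun x y => hD G (B i j k) m x y + ∑ l, B l j k x y * Γc G i l m x y
    - ∑ l, B i l k x y * Γc G l j m x y - ∑ l, B i j l x y * Γc G l k m x y

/-- Riemann curvature `R^i_k`. -/
def Riem {n : ℕ} (G : Fin n → Vec n → Vec n → ℝ) (i k : Fin n) : Vec n → Vec n → ℝ :=
  fun x y => 2 * pdx (G i) k x y - ∑ j, y j * pdy (pdx (G i) j) k x y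
    + 2 * ∑ j, G j x y * Γc G i j k x y - ∑ s, Nc G i s x y * Nc G s k x y

/-- Ricci scalar `R := R^m_m/(n-1)`. -/
def Ricci {n : ℕ} (G : Fin n → Vec n → Vec n → ℝ) : Vec n → Vec n → ℝ :=
  fun x y => (∑ m, Riem G m m x y) / ((n : ℝ) - 1)

/-- The Weyl-type curvature `T^i_k := R^i_k - (R δ^i_k - ½ R_{·k} y^i)`. -/
def Tcurv {n : ℕ} (G : Fin n → Vec n → Vec n → ℝ) (i k : Fin n) : Vec n → Vec n → ℝ :=
  fun x y => Riem G i k x y -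
    (Ricci G x y * (if i = k then 1 else 0) - (1/2) * pdy (Ricci G) k x y * y i)

/-- The χ-curvature `χ_i := -(1/3) T^m_{i·m}`. -/
def chiC {n : ℕ} (G : Fin n → Vec n → Vec n → ℝ) (i : Fin n) : Vec n → Vec n → ℝ :=
  fun x y => -(1/3) * ∑ m, pdy (Tcurv G m i) m x y

/-- The Weyl curvature `W^i_k := T^i_k + (3χ_k/(n+1)) y^i`. -/
def Weyl {n : ℕ} (G : Fin n → Vec n → Vec n → ℝ) (i k : Fin n) : Vec n → Vec n → ℝ :=
  fun x y => Tcurv G i k x y + (3 * chiC G k x y / ((n : ℝ) + 1)) * y i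

/-- A volume form `dV = σ(x) dx` on `U`: `σ` smooth and positive. -/
def IsVolumeForm {n : ℕ} (U : Set (Vec n)) (σ : Vec n → ℝ) : Prop :=
  ContDiffOn ℝ (⊤ : ℕ∞) σ U ∧ ∀ x ∈ U, 0 < σ x

/-- The S-curvature of `(G, dV)`: `S := ∂G^m/∂y^m - y^m ∂(ln σ)/∂x^m`. -/
def Scurv {n : ℕ} (G : Fin n → Vec n → Vec n → ℝ) (σ : Vec n → ℝ) : Vec n → Vec n → ℝ :=
  fun x y => ∑ m, Nc G m m x y
    - ∑ m, y m * fderiv ℝ (fun x' => Real.log (σ x')) x (Pi.single m 1)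

/-- The projective spray `Ĝ^i := G^i - (S/(n+1)) y^i` of `(G, dV)`. -/
def Ghat {n : ℕ} (G : Fin n → Vec n → Vec n → ℝ) (σ : Vec n → ℝ) :
    Fin n → Vec n → Vec n → ℝ :=
  fun i x y => G i x y - (Scurv G σ x y / ((n : ℝ) + 1)) * y i

/-- The Berwald–Weyl curvature `W^o_k := R̂_{∥k} - ½ R̂_{·k∥m} y^m` of `(G, dV)`,
where all hatted quantities and `∥` are taken with respect to the projective spray `Ĝ`. -/
def BWeyl {n : ℕ} (G : Fin n → Vec n → Vec n → ℝ) (σ : Vec n → ℝ) (k : Fin n) :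
    Vec n → Vec n → ℝ :=
  fun x y => hD (Ghat G σ) (Ricci (Ghat G σ)) k x y
    - (1/2) * ∑ m, covD1 (Ghat G σ) (fun j => pdy (Ricci (Ghat G σ)) j) k m x y * y m


/-- A commutative algebra with commuting base derivations `X i`, vertical derivations `Y i`, and
fibre coordinates `y i`, modelled on the smooth functions on an open subset of the slit tangent
bundle. -/
structure SlitCalculus (n : ℕ) (A : Type*) [CommRing A] [Algebra ℝ A] where
  X : Fin n → Derivation ℝ A A
  Y : Fin n → Derivation ℝ A A
  y : Fin n → A
  X_X : ∀ i j a, X i (X j a) = X j (X i a)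
  Y_Y : ∀ i j a, Y i (Y j a) = Y j (Y i a)
  Y_X : ∀ i j a, Y i (X j a) = X j (Y i a)
  X_y : ∀ i j, X i (y j) = 0
  Y_y : ∀ i j, Y i (y j) = if j = i then 1 else 0

namespace SlitCalculus

variable {n : ℕ} {A : Type*} [CommRing A] [Algebra ℝ A] (C : SlitCalculus n A)
  (G : Fin n → A)

lemma derivation_sum_apply {B : Type*} [CommRing B] [Algebra ℝ B] {κ : Type*} (s : Finset κ)
    (D : κ → Derivation ℝ B B) (a : B) : (∑ j ∈ s, D j) a = ∑ j ∈ s, D j a := by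
  rw [← Derivation.coeFnAddMonoidHom_apply, map_sum, Finset.sum_apply]
  rfl

lemma derivation_two {B : Type*} [CommRing B] [Algebra ℝ B] (D : Derivation ℝ B B) :
    D 2 = 0 := by
  simpa using D.map_natCast 2

/-- The Euler (Liouville) derivation `y^j ∂/∂y^j`. -/
def euler : Derivation ℝ A A := ∑ j, C.y j • C.Y j

/-- The spray `y^j ∂/∂x^j - 2 G^j ∂/∂y^j` as a derivation. -/
def spray : Derivation ℝ A A := ∑ j, (C.y j • C.X j - (2 * G j) • C.Y j)

/-- The horizontal derivation `δ/δx^k`. -/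
def hor (k : Fin n) : Derivation ℝ A A := C.X k - ∑ l, C.Y k (G l) • C.Y l

/-- The Riemann curvature. -/
def riem (i k : Fin n) : A :=
  2 * C.X k (G i) - C.spray G (C.Y k (G i)) - ∑ s, C.Y s (G i) * C.Y k (G s)

/-- The trace of the Riemann curvature. -/
def riemTrace : A := ∑ m, C.riem G m m

/-- The Ricci scalar. -/
def ricci : A := C.riemTrace G * algebraMap ℝ A ((n : ℝ) - 1)⁻¹

/-- The curvature `T^i_k`. -/
def tcurv (i k : Fin n) : A :=
  C.riem G i k - (C.ricci G * (if i = k then 1 else 0)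
    - algebraMap ℝ A (1 / 2) * C.Y k (C.ricci G) * C.y i)

/-- The χ-curvature. -/
def chi (i : Fin n) : A := algebraMap ℝ A (-(1 / 3)) * ∑ m, C.Y m (C.tcurv G m i)

/-- The Weyl curvature. -/
def weyl (i k : Fin n) : A :=
  C.tcurv G i k + algebraMap ℝ A 3 * C.chi G k * algebraMap ℝ A ((n : ℝ) + 1)⁻¹ * C.y i

lemma euler_apply (a : A) : C.euler a = ∑ j, C.y j * C.Y j a := by
  simp [euler, derivation_sum_apply]

lemma spray_apply (a : A) :
    C.spray G a = ∑ j, C.y j * C.X j a - 2 * ∑ j, G j * C.Y j a := by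
  simp [spray, derivation_sum_apply, Finset.mul_sum, mul_assoc]

lemma hor_apply (k : Fin n) (a : A) :
    C.hor G k a = C.X k a - ∑ l, C.Y k (G l) * C.Y l a := by
  simp [hor, derivation_sum_apply]

lemma euler_y (i : Fin n) : C.euler (C.y i) = C.y i := by
  simp [euler_apply, Y_y]

lemma spray_y (i : Fin n) : C.spray G (C.y i) = -(2 * G i) := by
  simp [spray_apply, Y_y, X_y]

lemma hor_y (k i : Fin n) : C.hor G k (C.y i) = -C.Y k (G i) := by
  simp [hor_apply, Y_y, X_y]

lemma Y_euler (k : Fin n) (a : A) : C.Y k (C.euler a) = C.euler (C.Y k a) + C.Y k a := by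
  simp [euler_apply, Y_y, Finset.sum_add_distrib, C.Y_Y k]

lemma X_euler (k : Fin n) (a : A) : C.X k (C.euler a) = C.euler (C.X k a) := by
  simp [euler_apply, X_y, C.Y_X]

lemma euler_Y {a c : A} (hc : ∀ k, C.Y k c = 0) (h : C.euler a = c * a) (k : Fin n) :
    C.euler (C.Y k a) = (c - 1) * C.Y k a := by
  have := congrArg (C.Y k) h
  rw [Y_euler] at this
  simp [hc] at this
  linear_combination this

lemma Y_spray (k : Fin n) (a : A) : C.Y k (C.spray G a) =
    C.spray G (C.Y k a) + C.X k a - 2 * ∑ j, C.Y k (G j) * C.Y j a := by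
  simp [spray_apply, Y_y, Finset.sum_add_distrib, C.Y_Y k, C.Y_X k, derivation_two, mul_comm]
  ring

lemma spray_eq_sum_hor (hG : ∀ i, C.euler (G i) = 2 * G i) (a : A) :
    C.spray G a = ∑ k, C.y k * C.hor G k a := by
  simp only [hor_apply, spray_apply, mul_sub, Finset.sum_sub_distrib, Finset.mul_sum]
  rw [Finset.sum_comm (γ := Fin n) (f := fun k l => C.y k * (C.Y k (G l) * C.Y l a))]
  congr 1
  refine Finset.sum_congr rfl fun l _ => ?_
  have := hG l
  rw [euler_apply] at this
  simp only [← mul_assoc, ← Finset.sum_mul, this]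

lemma euler_spray (hG : ∀ i, C.euler (G i) = 2 * G i) (a : A) :
    C.euler (C.spray G a) = C.spray G (C.euler a) + C.spray G a := by
  have hY : ∀ k, C.euler (C.Y k a) = C.Y k (C.euler a) - C.Y k a := fun k => by
    rw [Y_euler]; ring
  simp only [spray_apply, map_sub, map_sum, Derivation.leibniz, smul_eq_mul, euler_y, hG,
    ← X_euler, hY, derivation_two]
  simp only [Finset.mul_sum, mul_zero, add_zero, ← Finset.sum_add_distrib, ← Finset.sum_sub_distrib]
  refine Finset.sum_congr rfl fun l _ => ?_
  ring

/-- The curvature of the nonlinear connection: `[δ_k, δ_l] = -K^i_{kl} ∂/∂y^i`. -/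
def nlCurv (i k l : Fin n) : A := C.hor G k (C.Y l (G i)) - C.hor G l (C.Y k (G i))

lemma hor_commutator (k l : Fin n) (a : A) :
    C.hor G k (C.hor G l a) - C.hor G l (C.hor G k a)
      = -∑ i, C.nlCurv G i k l * C.Y i a := by
  have key : ∀ k l, C.hor G k (C.hor G l a) =
      (C.X k (C.X l a) - ∑ i, C.Y k (G i) * C.X l (C.Y i a)
        - ∑ i, C.Y l (G i) * C.X k (C.Y i a)
        + ∑ i, ∑ j, C.Y l (G i) * (C.Y k (G j) * C.Y j (C.Y i a)))
      - ∑ i, C.hor G k (C.Y l (G i)) * C.Y i a := by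
    intro k l
    rw [C.hor_apply G l a, map_sub, map_sum]
    simp only [Derivation.leibniz, smul_eq_mul, Finset.sum_add_distrib]
    have h1 : ∀ i, C.hor G k (C.Y i a) = C.X k (C.Y i a) - ∑ j, C.Y k (G j) * C.Y j (C.Y i a) :=
      fun i => C.hor_apply G k _
    simp only [h1, C.hor_apply G k (C.X l a), C.Y_X, mul_sub, Finset.sum_sub_distrib,
      Finset.mul_sum, mul_comm (C.Y _ a)]
    ring
  rw [key k l, key l k, C.X_X k l, Finset.sum_comm (γ := Fin n)
    (f := fun i j => C.Y l (G i) * (C.Y k (G j) * C.Y j (C.Y i a)))]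
  have h2 : ∑ j, ∑ i, C.Y l (G i) * (C.Y k (G j) * C.Y j (C.Y i a))
      = ∑ i, ∑ j, C.Y k (G i) * (C.Y l (G j) * C.Y j (C.Y i a)) :=
    Finset.sum_congr rfl fun i _ => Finset.sum_congr rfl fun j _ => by rw [C.Y_Y i j]; ring
  simp only [nlCurv, sub_mul, Finset.sum_sub_distrib, h2]
  ring

lemma nlCurv_bianchi (i k l m : Fin n) :
    (C.hor G m (C.nlCurv G i k l) + ∑ j, C.nlCurv G j k l * C.Y j (C.Y m (G i)))
    + (C.hor G k (C.nlCurv G i l m) + ∑ j, C.nlCurv G j l m * C.Y j (C.Y k (G i)))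
    + (C.hor G l (C.nlCurv G i m k) + ∑ j, C.nlCurv G j m k * C.Y j (C.Y l (G i))) = 0 := by
  have h1 := C.hor_commutator G k l (C.Y m (G i))
  have h2 := C.hor_commutator G l m (C.Y k (G i))
  have h3 := C.hor_commutator G m k (C.Y l (G i))
  have e : ∀ p q r, C.hor G p (C.nlCurv G i q r) =
      C.hor G p (C.hor G q (C.Y r (G i))) - C.hor G p (C.hor G r (C.Y q (G i))) :=
    fun p q r => map_sub _ _ _
  rw [e, e, e]
  linear_combination h1 + h2 + h3

lemma sum_y_nlCurv (hG : ∀ i, C.euler (G i) = 2 * G i) (i l : Fin n) :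
    ∑ k, C.y k * C.nlCurv G i k l = -C.riem G i l := by
  have h : C.hor G l (C.euler (G i)) = 2 * C.hor G l (G i) := by
    rw [hG, two_mul, map_add, two_mul]
  rw [euler_apply, map_sum] at h
  simp only [Derivation.leibniz, smul_eq_mul, Finset.sum_add_distrib, hor_y] at h
  simp only [nlCurv, mul_sub, Finset.sum_sub_distrib, ← C.spray_eq_sum_hor G hG, riem]
  have e := C.hor_apply G l (G i)
  simp only [mul_neg, Finset.sum_neg_distrib] at h
  simp only [mul_comm (C.Y l (G _))] at e
  linear_combination -h -2 * e

/-- The contracted Bianchi identity for the Riemann curvature. -/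
lemma riem_divergence (hG : ∀ i, C.euler (G i) = 2 * G i) (l : Fin n) :
    ∑ m, (C.hor G m (C.riem G m l) + ∑ j, C.riem G j l * C.Y m (C.Y j (G m))
        - ∑ j, C.riem G m j * C.Y m (C.Y l (G j)))
      = C.hor G l (C.riemTrace G) + C.spray G (∑ m, C.nlCurv G m l m)
        - ∑ k, C.Y l (G k) * ∑ m, C.nlCurv G m k m := by
  have hY : ∀ i m, ∑ k, C.y k * C.Y k (C.Y m (G i)) = C.Y m (G i) := fun i m => by
    rw [← euler_apply, C.euler_Y (c := 2) (fun k => derivation_two _) (hG i)]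
    ring
  have key : ∀ i m, -C.hor G m (C.riem G i l) + ∑ k, C.Y m (G k) * C.nlCurv G i k l
      - ∑ j, C.riem G j l * C.Y m (C.Y j (G i)) + C.spray G (C.nlCurv G i l m)
      + ∑ j, C.nlCurv G j l m * C.Y j (G i) + C.hor G l (C.riem G i m)
      + ∑ k, C.Y l (G k) * C.nlCurv G i m k + ∑ j, C.riem G j m * C.Y j (C.Y l (G i)) = 0 := by
    intro i m
    have h0 : ∑ k, C.y k * _ = ∑ k, C.y k * (0 : A) :=
      Finset.sum_congr rfl fun k _ => congrArg _ (C.nlCurv_bianchi G i k l m)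
    have anti : ∀ j k m, C.nlCurv G j m k = -C.nlCurv G j k m := fun j k m => by
      simp [nlCurv]
    have hR : ∀ m l, C.hor G m (C.riem G i l) =
        ∑ k, C.Y m (G k) * C.nlCurv G i k l - ∑ k, C.y k * C.hor G m (C.nlCurv G i k l) := by
      intro m l
      have := congrArg (C.hor G m) (C.sum_y_nlCurv G hG i l)
      simp only [map_sum, Derivation.leibniz, smul_eq_mul, hor_y, map_neg,
        Finset.sum_add_distrib, mul_comm (C.nlCurv G _ _ _), neg_mul,
        Finset.sum_neg_distrib] at this
      linear_combination this
    have hQ : ∀ m l, ∑ j, C.riem G j l * C.Y j (C.Y m (G i))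
        = - ∑ k, C.y k * ∑ j, C.nlCurv G j k l * C.Y j (C.Y m (G i)) := by
      intro m l
      simp only [Finset.mul_sum]
      rw [Finset.sum_comm, ← Finset.sum_neg_distrib]
      refine Finset.sum_congr rfl fun j _ => ?_
      rw [← neg_neg (C.riem G j l), ← C.sum_y_nlCurv G hG j l]
      simp only [neg_mul, Finset.sum_mul, mul_assoc]
    have hS : ∑ j, C.nlCurv G j l m * C.Y j (G i)
        = ∑ k, C.y k * ∑ j, C.nlCurv G j l m * C.Y j (C.Y k (G i)) := by
      simp only [Finset.mul_sum]
      rw [Finset.sum_comm]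
      refine Finset.sum_congr rfl fun j _ => ?_
      conv_lhs => rw [← hY i j, Finset.mul_sum]
      exact Finset.sum_congr rfl fun k _ => by rw [C.Y_Y j k]; ring
    simp only [mul_add, Finset.sum_add_distrib, mul_zero, Finset.sum_const_zero, anti _ _ m,
      map_neg, neg_mul, mul_neg, Finset.sum_neg_distrib] at h0
    simp only [C.Y_Y m, hR, hQ, hS, C.spray_eq_sum_hor G hG, anti _ _ m,
      mul_neg, Finset.sum_neg_distrib]
    linear_combination h0
  have tr : ∑ m, _ = ∑ m : Fin n, (0 : A) := Finset.sum_congr rfl fun m _ => key m m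
  have anti : ∑ m, ∑ j, C.nlCurv G j l m * C.Y j (G m)
      = -∑ m, ∑ k, C.Y m (G k) * C.nlCurv G m k l := by
    rw [Finset.sum_comm]
    simp only [← Finset.sum_neg_distrib]
    refine Finset.sum_congr rfl fun j _ => Finset.sum_congr rfl fun m _ => ?_
    simp only [nlCurv]; ring
  have sw : ∑ m, ∑ k, C.Y l (G k) * C.nlCurv G m m k
      = -∑ k, ∑ m, C.Y l (G k) * C.nlCurv G m k m := by
    rw [Finset.sum_comm]
    simp only [← Finset.sum_neg_distrib]
    refine Finset.sum_congr rfl fun j _ => Finset.sum_congr rfl fun m _ => ?_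
    simp only [nlCurv]; ring
  have sw2 : ∑ m, ∑ j, C.riem G m j * C.Y m (C.Y l (G j))
      = ∑ m, ∑ j, C.riem G j m * C.Y j (C.Y l (G m)) := Finset.sum_comm
  simp only [Finset.sum_add_distrib, Finset.sum_sub_distrib, Finset.sum_neg_distrib,
    Finset.sum_const_zero, anti, sw] at tr
  simp only [Finset.sum_add_distrib, Finset.sum_sub_distrib, riemTrace, map_sum, Finset.mul_sum,
    sw2]
  linear_combination -tr

lemma sum_Y_riem (k : Fin n) :
    ∑ m, C.Y m (C.riem G m k) = 2 * C.X k (∑ m, C.Y m (G m))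
      - C.spray G (C.Y k (∑ m, C.Y m (G m))) - ∑ m, C.X m (C.Y k (G m))
      + ∑ m, ∑ s, C.Y m (G s) * C.Y s (C.Y k (G m))
      - ∑ s, C.Y k (G s) * C.Y s (∑ m, C.Y m (G m)) := by
  have e : ∀ m, C.Y m (C.riem G m k) = 2 * C.X k (C.Y m (G m))
      - (C.spray G (C.Y k (C.Y m (G m))) + C.X m (C.Y k (G m))
          - 2 * ∑ s, C.Y m (G s) * C.Y s (C.Y k (G m)))
      - (∑ s, C.Y s (G m) * C.Y m (C.Y k (G s))
        + ∑ s, C.Y k (G s) * C.Y s (C.Y m (G m))) := by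
    intro m
    simp only [riem, map_sub, map_sum, Derivation.leibniz, smul_eq_mul, derivation_two, Y_spray,
      C.Y_X, C.Y_Y m, Finset.sum_add_distrib]
    simp
  have sw : ∑ m, ∑ s, C.Y s (G m) * C.Y m (C.Y k (G s))
      = ∑ m, ∑ s, C.Y m (G s) * C.Y s (C.Y k (G m)) := Finset.sum_comm
  have sw2 : ∑ m, ∑ s, C.Y k (G s) * C.Y s (C.Y m (G m))
      = ∑ s, C.Y k (G s) * ∑ m, C.Y s (C.Y m (G m)) := by
    rw [Finset.sum_comm]
    simp only [Finset.mul_sum]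
  simp only [e, map_sum, Finset.sum_add_distrib, Finset.sum_sub_distrib, ← Finset.mul_sum,
    sw, sw2]
  ring

lemma Y_riemTrace (k : Fin n) :
    C.Y k (C.riemTrace G) = 2 * ∑ m, C.X m (C.Y k (G m))
      - C.spray G (C.Y k (∑ m, C.Y m (G m))) - C.X k (∑ m, C.Y m (G m))
      + 2 * ∑ s, C.Y k (G s) * C.Y s (∑ m, C.Y m (G m))
      - 2 * ∑ m, ∑ s, C.Y m (G s) * C.Y s (C.Y k (G m)) := by
  have e : ∀ m, C.Y k (C.riem G m m) = 2 * C.X m (C.Y k (G m))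
      - (C.spray G (C.Y k (C.Y m (G m))) + C.X k (C.Y m (G m))
          - 2 * ∑ s, C.Y k (G s) * C.Y s (C.Y m (G m)))
      - (∑ s, C.Y s (G m) * C.Y m (C.Y k (G s)) + ∑ s, C.Y m (G s) * C.Y s (C.Y k (G m))) := by
    intro m
    simp only [riem, map_sub, map_sum, Derivation.leibniz, smul_eq_mul, derivation_two, Y_spray,
      C.Y_X, C.Y_Y k, Finset.sum_add_distrib]
    simp
  have sw : ∑ m, ∑ s, C.Y s (G m) * C.Y m (C.Y k (G s))
      = ∑ m, ∑ s, C.Y m (G s) * C.Y s (C.Y k (G m)) := Finset.sum_comm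
  have sw2 : ∑ m, ∑ s, C.Y k (G s) * C.Y s (C.Y m (G m))
      = ∑ s, C.Y k (G s) * ∑ m, C.Y s (C.Y m (G m)) := by
    rw [Finset.sum_comm]
    simp only [Finset.mul_sum]
  simp only [riemTrace, e, map_sum, Finset.sum_add_distrib, Finset.sum_sub_distrib,
    ← Finset.mul_sum, sw, sw2]
  ring

lemma sum_nlCurv (k : Fin n) :
    ∑ m, C.nlCurv G m k m = C.X k (∑ m, C.Y m (G m))
      - ∑ s, C.Y k (G s) * C.Y s (∑ m, C.Y m (G m)) - ∑ m, C.X m (C.Y k (G m))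
      + ∑ m, ∑ s, C.Y m (G s) * C.Y s (C.Y k (G m)) := by
  simp only [nlCurv, hor_apply, map_sum, Finset.sum_sub_distrib, Finset.mul_sum]
  rw [Finset.sum_comm (f := fun m s => C.Y k (G s) * C.Y s (C.Y m (G m)))]
  ring

section TraceClosed

variable (htr : ∀ k, C.spray G (C.Y k (∑ m, C.Y m (G m))) = C.X k (∑ m, C.Y m (G m)))
include htr

lemma sum_Y_riem_of_trace_closed (k : Fin n) :
    2 * ∑ m, C.Y m (C.riem G m k) = -C.Y k (C.riemTrace G) := by
  rw [sum_Y_riem, Y_riemTrace, htr]; ring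

lemma sum_nlCurv_of_trace_closed (k : Fin n) :
    2 * ∑ m, C.nlCurv G m k m = -C.Y k (C.riemTrace G) := by
  rw [sum_nlCurv, Y_riemTrace, htr]; ring

end TraceClosed

/-- The Berwald–Weyl expression `R_{|k} - ½ R_{·k|m} y^m` of a spray. -/
def bweyl (k : Fin n) : A :=
  C.hor G k (C.ricci G) - algebraMap ℝ A (1 / 2) *
    ∑ m, (C.hor G m (C.Y k (C.ricci G))
      - ∑ l, C.Y l (C.ricci G) * C.Y m (C.Y k (G l))) * C.y m

/-- The horizontal divergence `W^m_{k|m}` of a (1,1)-tensor. -/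
def divergence (W : Fin n → Fin n → A) (k : Fin n) : A :=
  ∑ m, (C.hor G m (W m k) + ∑ l, W l k * C.Y m (C.Y l (G m))
    - ∑ l, W m l * C.Y m (C.Y k (G l)))

lemma algebraMap_half_mul_two : algebraMap ℝ A (1 / 2) * 2 = 1 := by
  rw [← map_ofNat (algebraMap ℝ A) 2, ← map_mul]; norm_num

lemma algebraMap_inv_mul {r : ℝ} (hr : r ≠ 0) :
    algebraMap ℝ A r⁻¹ * algebraMap ℝ A r = 1 := by
  rw [← map_mul, inv_mul_cancel₀ hr, map_one]

lemma ricci_mul (hn : (n : ℝ) - 1 ≠ 0) : C.ricci G * ((n : A) - 1) = C.riemTrace G := by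
  have := algebraMap_inv_mul (A := A) hn
  rw [map_sub (algebraMap ℝ A), map_natCast, map_one] at this
  rw [ricci]
  linear_combination C.riemTrace G * this

section Homogeneous

variable (hG : ∀ i, C.euler (G i) = 2 * G i)
include hG

lemma euler_Y_self (k i : Fin n) : C.euler (C.Y k (G i)) = C.Y k (G i) := by
  rw [C.euler_Y (c := 2) (fun k => derivation_two _) (hG i)]
  ring

lemma euler_riem (i k : Fin n) : C.euler (C.riem G i k) = 2 * C.riem G i k := by
  simp only [riem, map_sub, map_sum, Derivation.leibniz, smul_eq_mul, derivation_two, mul_zero,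
    add_zero, ← X_euler, hG, C.euler_spray G hG, C.euler_Y_self G hG, Finset.sum_add_distrib,
    mul_comm (C.Y k _)]
  ring

lemma euler_ricci : C.euler (C.ricci G) = 2 * C.ricci G := by
  simp only [ricci, riemTrace, map_sum, Derivation.leibniz, smul_eq_mul, Derivation.map_algebraMap,
    mul_zero, zero_add, C.euler_riem G hG, ← Finset.mul_sum]
  ring

lemma euler_Y_ricci (k : Fin n) : C.euler (C.Y k (C.ricci G)) = C.Y k (C.ricci G) := by
  rw [C.euler_Y (c := 2) (fun k => derivation_two _) (C.euler_ricci G hG)]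
  ring

lemma bweyl_eq (k : Fin n) : C.bweyl G k = C.hor G k (C.ricci G) - algebraMap ℝ A (1 / 2) *
    (C.spray G (C.Y k (C.ricci G)) - ∑ l, C.Y k (G l) * C.Y l (C.ricci G)) := by
  have : ∑ m, ∑ l, C.Y l (C.ricci G) * C.Y m (C.Y k (G l)) * C.y m
      = ∑ l, C.Y k (G l) * C.Y l (C.ricci G) := by
    rw [Finset.sum_comm]
    refine Finset.sum_congr rfl fun l _ => ?_
    have := C.euler_Y_self G hG k l
    rw [euler_apply] at this
    conv_rhs => rw [← this, Finset.sum_mul]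
    exact Finset.sum_congr rfl fun m _ => by ring
  rw [bweyl, C.spray_eq_sum_hor G hG]
  simp only [sub_mul, Finset.sum_sub_distrib, Finset.sum_mul, this, mul_comm (C.hor G _ _)]

section TraceClosed

variable (hn : (n : ℝ) - 1 ≠ 0)
  (htr : ∀ k, C.spray G (C.Y k (∑ m, C.Y m (G m))) = C.X k (∑ m, C.Y m (G m)))
include hn htr

lemma divergence_riem (k : Fin n) :
    C.divergence G (C.riem G) k = ((n : A) - 1) * C.bweyl G k := by
  have hκ : ∀ k, ∑ m, C.nlCurv G m k m
      = algebraMap ℝ A (1 / 2) * (-(C.Y k (C.ricci G) * ((n : A) - 1))) := by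
    intro k
    have h := C.sum_nlCurv_of_trace_closed G htr k
    rw [← C.ricci_mul G hn, Derivation.leibniz] at h
    simp only [map_sub, Derivation.map_natCast, Derivation.map_one_eq_zero, smul_eq_mul] at h
    linear_combination algebraMap ℝ A (1 / 2) * h
      - (∑ m, C.nlCurv G m k m) * algebraMap_half_mul_two (A := A)
  have h := C.riem_divergence G hG k
  rw [divergence, h, C.bweyl_eq G hG, ← C.ricci_mul G hn]
  simp only [hκ, Derivation.leibniz, map_neg, map_sub, Derivation.map_natCast,
    Derivation.map_one_eq_zero, smul_eq_mul, Derivation.map_algebraMap]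
  have : ∑ l, C.Y k (G l) * (algebraMap ℝ A (1 / 2) * (-(C.Y l (C.ricci G) * ((n : A) - 1))))
      = -(algebraMap ℝ A (1 / 2) * ((n : A) - 1) * ∑ l, C.Y k (G l) * C.Y l (C.ricci G)) := by
    rw [Finset.mul_sum, ← Finset.sum_neg_distrib]
    exact Finset.sum_congr rfl fun l _ => by ring
  rw [this]
  ring

lemma chi_of_trace_closed (k : Fin n) : C.chi G k = 0 := by
  have hY : ∀ m, C.Y m (C.tcurv G m k) = C.Y m (C.riem G m k)
      - (C.Y m (C.ricci G) * (if m = k then 1 else 0))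
      + algebraMap ℝ A (1 / 2) * (C.y m * C.Y m (C.Y k (C.ricci G)) + C.Y k (C.ricci G)) := by
    intro m
    have h0 : C.Y m (if m = k then (1 : A) else 0) = 0 := by split_ifs <;> simp
    simp only [tcurv, map_sub, Derivation.leibniz, smul_eq_mul, h0, Derivation.map_algebraMap, Y_y]
    simp only [if_true]
    ring
  have h := C.sum_Y_riem_of_trace_closed G htr k
  rw [← C.ricci_mul G hn, Derivation.leibniz] at h
  simp only [map_sub, Derivation.map_natCast, Derivation.map_one_eq_zero, smul_eq_mul] at h
  have hE := C.euler_Y_ricci G hG k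
  rw [euler_apply] at hE
  have : ∑ m, C.Y m (C.tcurv G m k) = 0 := by
    simp only [hY, Finset.sum_add_distrib, Finset.sum_sub_distrib, ← Finset.mul_sum, hE]
    simp only [mul_ite, mul_one, mul_zero, Finset.sum_ite_eq', Finset.mem_univ, if_true,
      Finset.sum_const, Finset.card_univ, Fintype.card_fin, nsmul_eq_mul]
    linear_combination algebraMap ℝ A (1 / 2) * h
      + (C.Y k (C.ricci G) - ∑ m, C.Y m (C.riem G m k)) * algebraMap_half_mul_two (A := A)
  rw [chi, this, mul_zero]

lemma divergence_weyl_of_trace_closed (k : Fin n) :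
    C.divergence G (C.weyl G) k = ((n : A) - 2) * C.bweyl G k := by
  have hW : ∀ i k, C.weyl G i k = C.riem G i k - C.ricci G * (if i = k then 1 else 0)
      + algebraMap ℝ A (1 / 2) * C.Y k (C.ricci G) * C.y i := by
    intro i k
    rw [weyl, C.chi_of_trace_closed G hG hn htr, tcurv]; ring
  have hδ : ∀ m, C.hor G m (C.ricci G * (if m = k then (1 : A) else 0))
      = if m = k then C.hor G m (C.ricci G) else 0 := fun m => by split_ifs <;> simp
  have hR := C.divergence_riem G hG hn htr k
  simp only [divergence, Finset.sum_sub_distrib, Finset.sum_add_distrib] at hR ⊢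
  have hN : ∑ m, ∑ l, C.y l * C.Y m (C.Y l (G m)) = ∑ m, C.Y m (G m) :=
    Finset.sum_congr rfl fun m _ => by
      rw [← C.euler_Y_self G hG m m, euler_apply]
      simp only [C.Y_Y m]
  have hB : ∑ m, ∑ l, C.Y l (C.ricci G) * (C.y m * C.Y m (C.Y k (G l)))
      = ∑ l, C.Y k (G l) * C.Y l (C.ricci G) := by
    rw [Finset.sum_comm]
    refine Finset.sum_congr rfl fun l _ => ?_
    have := C.euler_Y_self G hG k l
    rw [euler_apply] at this
    rw [← Finset.mul_sum, this, mul_comm]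
  have a1 : ∀ m, C.hor G m (C.weyl G m k) = C.hor G m (C.riem G m k)
      - (if m = k then C.hor G m (C.ricci G) else 0)
      + algebraMap ℝ A (1 / 2) * (C.y m * C.hor G m (C.Y k (C.ricci G)))
      - algebraMap ℝ A (1 / 2) * C.Y k (C.ricci G) * C.Y m (G m) := by
    intro m
    rw [hW, map_add, map_sub, hδ]
    simp only [Derivation.leibniz, smul_eq_mul, hor_y, Derivation.map_algebraMap]
    ring
  have a2 : ∀ m, ∑ l, C.weyl G l k * C.Y m (C.Y l (G m))
      = ∑ l, C.riem G l k * C.Y m (C.Y l (G m)) - C.ricci G * C.Y m (C.Y k (G m))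
        + algebraMap ℝ A (1 / 2) * C.Y k (C.ricci G) * ∑ l, C.y l * C.Y m (C.Y l (G m)) := by
    intro m
    simp [hW, add_mul, sub_mul, Finset.sum_add_distrib, Finset.mul_sum, mul_assoc]
  have a3 : ∀ m, ∑ l, C.weyl G m l * C.Y m (C.Y k (G l))
      = ∑ l, C.riem G m l * C.Y m (C.Y k (G l)) - C.ricci G * C.Y m (C.Y k (G m))
        + algebraMap ℝ A (1 / 2) *
          ∑ l, C.Y l (C.ricci G) * (C.y m * C.Y m (C.Y k (G l))) := by
    intro m
    simp [hW, add_mul, sub_mul, Finset.sum_add_distrib, Finset.mul_sum, mul_assoc]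
  simp only [a1, a2, a3, Finset.sum_add_distrib, Finset.sum_sub_distrib, ← Finset.mul_sum, hN, hB,
    ← C.spray_eq_sum_hor G hG, Finset.sum_ite_eq', Finset.mem_univ, if_true]
  have hb := C.bweyl_eq G hG k
  linear_combination hR + hb

end TraceClosed

/-- The effect of a projective change `G^i + P y^i` on the Riemann curvature. -/
lemma riem_projective {P : A} (hP : C.euler P = P) (i k : Fin n) :
    C.riem (fun i => G i + P * C.y i) i k = C.riem G i k
      + (P * P - C.spray G P) * (if i = k then 1 else 0)
      + (2 * C.X k P - C.spray G (C.Y k P) - ∑ s, C.Y k (G s) * C.Y s P - P * C.Y k P) * C.y i := by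
  have hY : ∀ k i, C.Y k (G i + P * C.y i)
      = C.Y k (G i) + C.Y k P * C.y i + P * (if i = k then 1 else 0) := fun k i => by
    simp only [map_add, Derivation.leibniz, smul_eq_mul, Y_y]; ring
  have hS : ∀ a, C.spray (fun i => G i + P * C.y i) a = C.spray G a - 2 * P * C.euler a := by
    intro a
    simp only [spray_apply, euler_apply, add_mul, Finset.sum_add_distrib, mul_assoc,
      ← Finset.mul_sum]
    ring
  have hEP : ∀ k, C.euler (C.Y k P) = 0 := fun k => by
    have := C.Y_euler k P
    rw [hP] at this
    linear_combination -this
  have h0 : ∀ D : Derivation ℝ A A, D (if i = k then (1 : A) else 0) = 0 :=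
    fun D => by split_ifs <;> simp
  have hEN : C.euler (C.Y k (G i)) = C.Y k (G i) := C.euler_Y_self G hG k i
  have hNy : ∑ s, C.y s * C.Y s (G i) = 2 * G i := by rw [← euler_apply, hG]
  have hPy : ∑ s, C.y s * C.Y s P = P := by rw [← euler_apply, hP]
  have hsum : ∑ s, (C.Y s (G i) + C.Y s P * C.y i + P * (if i = s then 1 else 0))
        * (C.Y k (G s) + C.Y k P * C.y s + P * (if s = k then 1 else 0))
      = ∑ s, C.Y s (G i) * C.Y k (G s) + C.Y k P * (∑ s, C.y s * C.Y s (G i))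
        + P * C.Y k (G i) + C.y i * ∑ s, C.Y k (G s) * C.Y s P
        + C.y i * C.Y k P * (∑ s, C.y s * C.Y s P) + P * C.Y k P * C.y i
        + P * (C.Y k (G i) + C.Y k P * C.y i + P * (if i = k then 1 else 0)) := by
    have e : ∀ s, (C.Y s (G i) + C.Y s P * C.y i + P * (if i = s then 1 else 0))
        * (C.Y k (G s) + C.Y k P * C.y s + P * (if s = k then 1 else 0))
        = C.Y s (G i) * C.Y k (G s) + C.Y k P * (C.y s * C.Y s (G i))
        + (if s = k then P * C.Y s (G i) else 0) + C.y i * (C.Y k (G s) * C.Y s P)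
        + C.y i * C.Y k P * (C.y s * C.Y s P) + (if s = k then P * C.Y s P * C.y i else 0)
        + (if i = s then P * (C.Y k (G s) + C.Y k P * C.y s + P * (if s = k then 1 else 0))
            else 0) := by
      intro s
      split_ifs <;> ring
    simp only [e, Finset.sum_add_distrib, ← Finset.mul_sum, Finset.sum_ite_eq', Finset.sum_ite_eq,
      Finset.mem_univ, if_true]
  rw [riem, riem]
  simp only [hY, hS, hsum, hNy, hPy]
  simp only [map_add, Derivation.leibniz, smul_eq_mul, X_y, spray_y, euler_y, hEP, hP, h0, hEN]
  ring

lemma weyl_projective {P : A} (hP : C.euler P = P) (hn : (n : ℝ) - 1 ≠ 0) (i k : Fin n) :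
    C.weyl (fun i => G i + P * C.y i) i k = C.weyl G i k := by
  set G' : Fin n → A := fun i => G i + P * C.y i
  set Ξ := P * P - C.spray G P with hΞ
  set τ : Fin n → A := fun k =>
    2 * C.X k P - C.spray G (C.Y k P) - ∑ s, C.Y k (G s) * C.Y s P - P * C.Y k P with hτ
  have hR : ∀ i k, C.riem G' i k = C.riem G i k + Ξ * (if i = k then 1 else 0) + τ k * C.y i :=
    C.riem_projective G hG hP
  have hEP : ∀ k, C.euler (C.Y k P) = 0 := fun k => by
    have := C.Y_euler k P
    rw [hP] at this
    linear_combination -this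
  have hΞ2 : C.euler Ξ = 2 * Ξ := by
    simp only [hΞ, map_sub, Derivation.leibniz, smul_eq_mul, hP, C.euler_spray G hG]
    ring
  have hτ1 : ∀ k, C.euler (τ k) = τ k := fun k => by
    simp only [hτ, map_sub, map_sum, Derivation.leibniz, smul_eq_mul, ← X_euler, hP,
      derivation_two, C.euler_spray G hG, hEP, C.euler_Y_self G hG, map_zero, mul_zero, add_zero,
      zero_add, mul_comm (C.Y _ P)]
  have hτy : ∑ m, τ m * C.y m = -Ξ := by
    have hPy : ∑ s, C.y s * C.Y s P = P := by rw [← euler_apply, hP]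
    have h1 := congrArg (C.spray G) hPy
    simp only [map_sum, Derivation.leibniz, smul_eq_mul, spray_y, Finset.sum_add_distrib,
      mul_neg, Finset.sum_neg_distrib] at h1
    have h2 := C.spray_apply G P
    have h3 : ∑ m, ∑ s, C.y m * (C.Y m (G s) * C.Y s P) = ∑ s, 2 * G s * C.Y s P := by
      rw [Finset.sum_comm]
      refine Finset.sum_congr rfl fun s _ => ?_
      rw [← hG, euler_apply, Finset.sum_mul]
      exact Finset.sum_congr rfl fun m _ => by ring
    have h4 : ∑ m, τ m * C.y m = 2 * ∑ m, C.y m * C.X m P - ∑ m, C.y m * C.spray G (C.Y m P)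
        - ∑ m, ∑ s, C.y m * (C.Y m (G s) * C.Y s P) - P * ∑ m, C.y m * C.Y m P := by
      simp only [Finset.mul_sum, ← Finset.sum_sub_distrib]
      refine Finset.sum_congr rfl fun m _ => ?_
      rw [← Finset.mul_sum]
      simp only [hτ]; ring
    have h5 : ∑ s, C.Y s P * (2 * G s) = 2 * ∑ s, G s * C.Y s P := by
      rw [Finset.mul_sum]; exact Finset.sum_congr rfl fun m _ => by ring
    have h6 : ∑ s, 2 * G s * C.Y s P = 2 * ∑ s, G s * C.Y s P := by
      rw [Finset.mul_sum]; exact Finset.sum_congr rfl fun m _ => by ring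
    rw [h4, h3, h6, hPy]
    rw [h5] at h1
    rw [hΞ]
    linear_combination -h1 - 2 * h2
  have hn' := algebraMap_inv_mul (A := A) hn
  rw [map_sub (algebraMap ℝ A), map_natCast, map_one] at hn'
  have hric : C.ricci G' = C.ricci G + Ξ := by
    simp only [ricci, riemTrace, hR, Finset.sum_add_distrib, hτy]
    simp only [if_true, mul_one, Finset.sum_const, Finset.card_univ, Fintype.card_fin, nsmul_eq_mul]
    linear_combination Ξ * hn'
  set θ : Fin n → A := fun k => τ k + algebraMap ℝ A (1 / 2) * C.Y k Ξ with hθ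
  have hT : ∀ i k, C.tcurv G' i k = C.tcurv G i k + θ k * C.y i := fun i k => by
    simp only [tcurv, hR, hric, map_add, hθ]; ring
  have hθ1 : ∀ k, C.euler (θ k) = θ k := fun k => by
    simp only [hθ, map_add, Derivation.leibniz, smul_eq_mul, Derivation.map_algebraMap, hτ1,
      C.euler_Y (c := 2) (fun k => derivation_two _) hΞ2]
    ring
  have hχ : C.chi G' k = C.chi G k + algebraMap ℝ A (-(1 / 3)) * (((n : A) + 1) * θ k) := by
    have h := hθ1 k
    rw [euler_apply] at h
    simp only [chi, hT, map_add, Derivation.leibniz, smul_eq_mul, Finset.sum_add_distrib, Y_y,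
      if_true, h, mul_one, Finset.sum_const, Finset.card_univ, Fintype.card_fin, nsmul_eq_mul]
    ring
  have h3 : algebraMap ℝ A 3 * algebraMap ℝ A (-(1 / 3)) = -1 := by
    rw [← map_mul, ← map_one (algebraMap ℝ A), ← map_neg]; norm_num
  have hn1 := algebraMap_inv_mul (A := A) (r := (n : ℝ) + 1) (by positivity)
  rw [map_add (algebraMap ℝ A) (n : ℝ), map_natCast, map_one] at hn1
  rw [weyl, weyl, hT, hχ]
  linear_combination θ k * C.y i * ((n : A) + 1) * algebraMap ℝ A ((n : ℝ) + 1)⁻¹ * h3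
    - θ k * C.y i * hn1

/-- The S-curvature for the volume form `exp L dx`. -/
def scurv (L : A) : A := ∑ m, C.Y m (G m) - ∑ m, C.y m * C.X m L

/-- The projective spray for the volume form `exp L dx`. -/
def projSpray (L : A) (i : Fin n) : A :=
  G i - C.scurv G L * algebraMap ℝ A ((n : ℝ) + 1)⁻¹ * C.y i

theorem divergence_weyl_projSpray (hn : (n : ℝ) - 1 ≠ 0) {L : A} (hL : ∀ j, C.Y j L = 0)
    (k : Fin n) :
    C.divergence (C.projSpray G L) (C.weyl G) k = ((n : A) - 2) * C.bweyl (C.projSpray G L) k := by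
  set P : A := -(C.scurv G L * algebraMap ℝ A ((n : ℝ) + 1)⁻¹) with hPdef
  have hYX : ∀ j m, C.Y j (C.X m L) = 0 := fun j m => by rw [C.Y_X, hL, map_zero]
  have hS : C.euler (C.scurv G L) = C.scurv G L := by
    have : ∀ m, C.euler (C.X m L) = 0 := fun m => by simp [euler_apply, hYX]
    simp only [scurv, map_sub, map_sum, Derivation.leibniz, smul_eq_mul, C.euler_Y_self G hG,
      euler_y, this, mul_zero, zero_add, mul_comm (C.X _ L)]
  have hP : C.euler P = P := by
    simp only [hPdef, map_neg, Derivation.leibniz, smul_eq_mul, Derivation.map_algebraMap, hS]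
    ring
  have hG' : C.projSpray G L = fun i => G i + P * C.y i := by
    funext i; simp only [projSpray, hPdef]; ring
  have hW : C.weyl G = C.weyl (C.projSpray G L) := by
    funext i k; rw [hG', C.weyl_projective G hG hP hn]
  have hE : ∀ i, C.euler (C.projSpray G L i) = 2 * C.projSpray G L i := fun i => by
    simp only [hG', map_add, Derivation.leibniz, smul_eq_mul, euler_y, hG, hP]; ring
  have hπ : ∑ m, C.Y m (C.projSpray G L m) = ∑ m, C.y m * C.X m L := by
    have hPy : ∑ s, C.y s * C.Y s P = P := by rw [← euler_apply, hP]
    have hn1 := algebraMap_inv_mul (A := A) (r := (n : ℝ) + 1) (by positivity)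
    rw [map_add (algebraMap ℝ A) (n : ℝ), map_natCast, map_one] at hn1
    have h : ∑ m, C.Y m (C.projSpray G L m) = ∑ m, C.Y m (G m) + P * n + P := by
      conv_rhs => rw [← hPy]
      simp only [hG', map_add, Derivation.leibniz, smul_eq_mul, Y_y, if_true, mul_one,
        Finset.sum_add_distrib, Finset.sum_const, Finset.card_univ, Fintype.card_fin, nsmul_eq_mul,
        hPy]
      ring
    rw [h, hPdef]
    have hs : C.scurv G L = ∑ m, C.Y m (G m) - ∑ m, C.y m * C.X m L := rfl
    linear_combination (-C.scurv G L) * hn1 - hs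
  have htr : ∀ k, C.spray (C.projSpray G L) (C.Y k (∑ m, C.Y m (C.projSpray G L m)))
      = C.X k (∑ m, C.Y m (C.projSpray G L m)) := fun k => by
    rw [hπ]
    simp [Derivation.leibniz, Y_y, X_y, hYX, spray_apply, C.X_X k]
  rw [hW]
  exact C.divergence_weyl_of_trace_closed _ hE hn htr k

end Homogeneous

end SlitCalculus

section SmoothFunctions

open TopologicalSpace

variable {E : Type*} [NormedAddCommGroup E] [NormedSpace ℝ E]

/-- The algebra of smooth real functions on an open set. -/
def smoothOn (Ω : Opens E) : Subalgebra ℝ (Ω → ℝ) where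
  carrier := {a | ∃ f : E → ℝ, ContDiffOn ℝ (⊤ : ℕ∞) f Ω ∧ ∀ p : Ω, f p = a p}
  mul_mem' := by
    rintro a b ⟨f, hf, hfa⟩ ⟨g, hg, hgb⟩
    exact ⟨fun p => f p * g p, hf.mul hg, fun p => by simp [hfa, hgb]⟩
  add_mem' := by
    rintro a b ⟨f, hf, hfa⟩ ⟨g, hg, hgb⟩
    exact ⟨fun p => f p + g p, hf.add hg, fun p => by simp [hfa, hgb]⟩
  algebraMap_mem' r := ⟨fun _ => r, contDiffOn_const, fun _ => rfl⟩

variable {Ω : Opens E}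

/-- An extension of a function on `Ω` to the whole space. -/
def zeroExtend (a : smoothOn Ω) : E → ℝ := Function.extend Subtype.val a.1 0

lemma zeroExtend_apply (a : smoothOn Ω) (p : Ω) : zeroExtend a p = a.1 p :=
  Subtype.val_injective.extend_apply _ _ _

lemma smoothOn.contDiffOn {a : smoothOn Ω} {f : E → ℝ} (h : ∀ p : Ω, f p = a.1 p) :
    ContDiffOn ℝ (⊤ : ℕ∞) f Ω := by
  obtain ⟨g, hg, hga⟩ := a.2
  exact hg.congr fun p hp => (h ⟨p, hp⟩).trans (hga ⟨p, hp⟩).symm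

lemma smoothOn.differentiableAt {a : smoothOn Ω} {f : E → ℝ} (h : ∀ p : Ω, f p = a.1 p)
    (p : Ω) : DifferentiableAt ℝ f p :=
  ((smoothOn.contDiffOn h).contDiffAt (Ω.isOpen.mem_nhds p.2)).differentiableAt (by simp)

lemma smoothOn.fderiv_eq {a : smoothOn Ω} {f g : E → ℝ} (hf : ∀ p : Ω, f p = a.1 p)
    (hg : ∀ p : Ω, g p = a.1 p) (p : Ω) : fderiv ℝ f p = fderiv ℝ g p := by
  apply Filter.EventuallyEq.fderiv_eq
  filter_upwards [Ω.isOpen.mem_nhds p.2] with q hq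
  exact (hf ⟨q, hq⟩).trans (hg ⟨q, hq⟩).symm

/-- The derivation of smooth functions given by differentiation along a constant vector. -/
def dirDeriv (Ω : Opens E) (v : E) : Derivation ℝ (smoothOn Ω) (smoothOn Ω) :=
  Derivation.mk'
    { toFun := fun a => ⟨fun p => fderiv ℝ (zeroExtend a) p v,
        fun p => fderiv ℝ (zeroExtend a) p v,
        ((smoothOn.contDiffOn (zeroExtend_apply a)).fderiv_of_isOpen Ω.isOpen (by simp)).clm_apply
          contDiffOn_const, fun _ => rfl⟩
      map_add' := fun a b => by
        ext p
        have h := smoothOn.fderiv_eq (f := fun q => zeroExtend a q + zeroExtend b q) (fun q => by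
          rw [zeroExtend_apply a, zeroExtend_apply b]; rfl) (zeroExtend_apply (a + b)) p
        change fderiv ℝ (zeroExtend (a + b)) p v
          = fderiv ℝ (zeroExtend a) p v + fderiv ℝ (zeroExtend b) p v
        rw [← h, fderiv_fun_add (smoothOn.differentiableAt (zeroExtend_apply a) p)
          (smoothOn.differentiableAt (zeroExtend_apply b) p)]
        rfl
      map_smul' := fun r a => by
        ext p
        have h := smoothOn.fderiv_eq (f := fun q => r • zeroExtend a q) (fun q => by
          rw [zeroExtend_apply a]; rfl) (zeroExtend_apply (r • a)) p
        change fderiv ℝ (zeroExtend (r • a)) p v = r • fderiv ℝ (zeroExtend a) p v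
        rw [← h, fderiv_fun_const_smul (smoothOn.differentiableAt (zeroExtend_apply a) p)]
        rfl }
    fun a b => by
      ext p
      have h := smoothOn.fderiv_eq (f := fun q => zeroExtend a q * zeroExtend b q) (fun q => by
        rw [zeroExtend_apply a, zeroExtend_apply b]; rfl) (zeroExtend_apply (a * b)) p
      change fderiv ℝ (zeroExtend (a * b)) p v
        = a.1 p * fderiv ℝ (zeroExtend b) p v + b.1 p * fderiv ℝ (zeroExtend a) p v
      rw [← h, fderiv_fun_mul (smoothOn.differentiableAt (zeroExtend_apply a) p)
        (smoothOn.differentiableAt (zeroExtend_apply b) p), zeroExtend_apply a, zeroExtend_apply b]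
      rfl

lemma dirDeriv_apply {a : smoothOn Ω} {f : E → ℝ} (h : ∀ p : Ω, f p = a.1 p) (v : E) (p : Ω) :
    (dirDeriv Ω v a).1 p = fderiv ℝ f p v := by
  rw [smoothOn.fderiv_eq h (zeroExtend_apply a) p]
  rfl

lemma dirDeriv_comm (v w : E) (a : smoothOn Ω) :
    dirDeriv Ω v (dirDeriv Ω w a) = dirDeriv Ω w (dirDeriv Ω v a) := by
  ext p
  have hs := smoothOn.contDiffOn (zeroExtend_apply a)
  have hd : DifferentiableAt ℝ (fderiv ℝ (zeroExtend a)) p :=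
    ((hs.fderiv_of_isOpen (m := 1) Ω.isOpen (by norm_cast)).contDiffAt
      (Ω.isOpen.mem_nhds p.2)).differentiableAt (by simp)
  have key : ∀ v w : E, (dirDeriv Ω v (dirDeriv Ω w a)).1 p
      = fderiv ℝ (fderiv ℝ (zeroExtend a)) p v w := by
    intro v w
    rw [dirDeriv_apply (f := fun q => fderiv ℝ (zeroExtend a) q w) (fun _ => rfl),
      fderiv_clm_apply hd (differentiableAt_const w)]
    simp
  rw [key, key]
  exact ((hs.contDiffAt (Ω.isOpen.mem_nhds p.2)).isSymmSndFDerivAt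
    (by rw [minSmoothness_of_isRCLikeNormedField]; exact WithTop.coe_le_coe.2 le_top)).eq v w

end SmoothFunctions

section Slit

open TopologicalSpace

variable {n : ℕ}

lemma isOpen_slit (n : ℕ) : IsOpen (slit n) := isOpen_ne

/-- The domain `U × (ℝⁿ \ {0})` as an open set. -/
def slitDomain {U : Set (Vec n)} (hU : IsOpen U) : Opens (Vec n × Vec n) :=
  ⟨U ×ˢ slit n, hU.prod (isOpen_slit n)⟩

variable {U : Set (Vec n)} (hU : IsOpen U)

/-- The fibre coordinate `y^i`. -/
def fibreCoord (i : Fin n) : smoothOn (slitDomain hU) :=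
  ⟨fun p => p.1.2 i, fun p => p.2 i, by fun_prop, fun _ => rfl⟩

lemma dirDeriv_fibreCoord (v : Vec n × Vec n) (i : Fin n) :
    dirDeriv (slitDomain hU) v (fibreCoord hU i) = algebraMap ℝ _ (v.2 i) := by
  ext p
  let L : Vec n × Vec n →L[ℝ] ℝ :=
    (ContinuousLinearMap.proj i).comp (ContinuousLinearMap.snd ℝ (Vec n) (Vec n))
  rw [dirDeriv_apply (f := L) (fun _ => rfl), L.fderiv]
  rfl

/-- The calculus of smooth functions on `U × (ℝⁿ \ {0})`. -/
def slitCalculus : SlitCalculus n (smoothOn (slitDomain hU)) where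
  X i := dirDeriv _ (Pi.single i 1, 0)
  Y i := dirDeriv _ (0, Pi.single i 1)
  y := fibreCoord hU
  X_X _ _ _ := dirDeriv_comm _ _ _
  Y_Y _ _ _ := dirDeriv_comm _ _ _
  Y_X _ _ _ := dirDeriv_comm _ _ _
  X_y i j := by rw [dirDeriv_fibreCoord]; simp
  Y_y i j := by
    rw [dirDeriv_fibreCoord]
    by_cases h : j = i <;> simp [h]

/-- The function `f` of `(x, y)` restricts to the element `a` on `U × (ℝⁿ \ {0})`. -/
def Represents (f : Vec n → Vec n → ℝ) (a : smoothOn (slitDomain hU)) : Prop :=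
  ∀ p : slitDomain hU, f p.1.1 p.1.2 = a.1 p

namespace Represents

variable {hU} {f g : Vec n → Vec n → ℝ} {a b : smoothOn (slitDomain hU)}

lemma add (hf : Represents hU f a) (hg : Represents hU g b) :
    Represents hU (fun x y => f x y + g x y) (a + b) := fun p => congrArg₂ _ (hf p) (hg p)

lemma sub (hf : Represents hU f a) (hg : Represents hU g b) :
    Represents hU (fun x y => f x y - g x y) (a - b) := fun p => congrArg₂ _ (hf p) (hg p)

lemma mul (hf : Represents hU f a) (hg : Represents hU g b) :
    Represents hU (fun x y => f x y * g x y) (a * b) := fun p => congrArg₂ _ (hf p) (hg p)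

lemma const (r : ℝ) : Represents hU (fun _ _ => r) (algebraMap ℝ _ r) := fun _ => rfl

lemma two : Represents hU (fun _ _ => 2) 2 := fun _ => rfl

lemma ite (i k : Fin n) :
    Represents hU (fun _ _ => if i = k then 1 else 0) (if i = k then 1 else 0) := by
  intro p
  split_ifs <;> rfl

lemma div_const (hf : Represents hU f a) (r : ℝ) :
    Represents hU (fun x y => f x y / r) (a * algebraMap ℝ _ r⁻¹) := fun p =>
  (div_eq_mul_inv _ _).trans (congrArg (· * r⁻¹) (hf p))

lemma sum {ι : Type*} {s : Finset ι} {f : ι → Vec n → Vec n → ℝ}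
    {a : ι → smoothOn (slitDomain hU)} (h : ∀ i, Represents hU (f i) (a i)) :
    Represents hU (fun x y => ∑ i ∈ s, f i x y) (∑ i ∈ s, a i) := fun p => by
  have : (∑ i ∈ s, a i).1 p = ∑ i ∈ s, (a i).1 p := by
    rw [AddSubmonoidClass.coe_finsetSum, Finset.sum_apply]
  rw [this]
  exact Finset.sum_congr rfl fun i _ => h i p

lemma coord (i : Fin n) : Represents hU (fun _ y => y i) ((slitCalculus hU).y i) :=
  fun _ => rfl

lemma pdx (hf : Represents hU f a) (i : Fin n) :
    Represents hU (pdx f i) ((slitCalculus hU).X i a) := fun p => by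
  have hd := smoothOn.differentiableAt (f := fun q : Vec n × Vec n => f q.1 q.2) hf p
  have h := HasFDerivAt.comp (f := fun x => (x, p.1.2)) p.1.1 hd.hasFDerivAt
    ((hasFDerivAt_id p.1.1).prodMk (hasFDerivAt_const p.1.2 p.1.1))
  have e := dirDeriv_apply (f := fun q : Vec n × Vec n => f q.1 q.2) hf (Pi.single i 1, 0) p
  refine Eq.trans ?_ e.symm
  have h' := congrArg (fun T => T (Pi.single i 1)) h.fderiv
  exact h'

lemma pdy (hf : Represents hU f a) (i : Fin n) :
    Represents hU (pdy f i) ((slitCalculus hU).Y i a) := fun p => by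
  have hd := smoothOn.differentiableAt (f := fun q : Vec n × Vec n => f q.1 q.2) hf p
  have h := HasFDerivAt.comp (f := fun y => (p.1.1, y)) p.1.2 hd.hasFDerivAt
    ((hasFDerivAt_const p.1.1 p.1.2).prodMk (hasFDerivAt_id p.1.2))
  have e := dirDeriv_apply (f := fun q : Vec n × Vec n => f q.1 q.2) hf (0, Pi.single i 1) p
  refine Eq.trans ?_ e.symm
  have h' := congrArg (fun T => T (Pi.single i 1)) h.fderiv
  exact h'

section Spray

variable {G : Fin n → Vec n → Vec n → ℝ} {Γ : Fin n → smoothOn (slitDomain hU)}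
  (hG : ∀ i, Represents hU (G i) (Γ i))
include hG

lemma hD (hf : Represents hU f a) (k : Fin n) :
    Represents hU (hD G f k) ((slitCalculus hU).hor Γ k a) := by
  rw [SlitCalculus.hor_apply]
  exact (hf.pdx k).sub (sum fun l => ((hG l).pdy k).mul (hf.pdy l))

lemma riem (i k : Fin n) : Represents hU (Riem G i k) ((slitCalculus hU).riem Γ i k) := by
  have h : (slitCalculus hU).riem Γ i k = 2 * (slitCalculus hU).X k (Γ i)
      - ∑ j, (slitCalculus hU).y j * (slitCalculus hU).Y k ((slitCalculus hU).X j (Γ i))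
      + 2 * ∑ j, Γ j * (slitCalculus hU).Y k ((slitCalculus hU).Y j (Γ i))
      - ∑ s, (slitCalculus hU).Y s (Γ i) * (slitCalculus hU).Y k (Γ s) := by
    rw [SlitCalculus.riem, SlitCalculus.spray_apply]
    simp only [(slitCalculus hU).Y_X, (slitCalculus hU).Y_Y k]
    ring
  rw [h]
  exact (((two.mul ((hG i).pdx k)).sub (sum fun j => (coord j).mul (((hG i).pdx j).pdy k))).add
    (two.mul (sum fun j => (hG j).mul (((hG i).pdy j).pdy k)))).sub
    (sum fun s => ((hG i).pdy s).mul ((hG s).pdy k))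

lemma ricci : Represents hU (Ricci G) ((slitCalculus hU).ricci Γ) :=
  (sum fun m => riem hG m m).div_const _

lemma tcurv (i k : Fin n) : Represents hU (Tcurv G i k) ((slitCalculus hU).tcurv Γ i k) :=
  (riem hG i k).sub (((ricci hG).mul (ite i k)).sub
    (((const (1 / 2)).mul ((ricci hG).pdy k)).mul (coord i)))

lemma chi (i : Fin n) : Represents hU (chiC G i) ((slitCalculus hU).chi Γ i) := by
  have h := (const (hU := hU) (-(1 / 3))).mul (sum (s := .univ) fun m => (tcurv hG m i).pdy m)
  intro p
  rw [← show _ = ((slitCalculus hU).chi Γ i).1 p from h p, chiC]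

lemma weyl (i k : Fin n) : Represents hU (Weyl G i k) ((slitCalculus hU).weyl Γ i k) :=
  (tcurv hG i k).add ((((const 3).mul (chi hG k)).div_const _).mul (coord i))

lemma divergence {W : Fin n → Fin n → Vec n → Vec n → ℝ}
    {w : Fin n → Fin n → smoothOn (slitDomain hU)} (hW : ∀ i k, Represents hU (W i k) (w i k))
    (k : Fin n) : Represents hU (fun x y => ∑ m, covD11 G W m k m x y)
      ((slitCalculus hU).divergence Γ w k) :=
  sum fun m => ((hD hG (hW m k) m).add
    (sum fun l => (hW l k).mul (((hG m).pdy l).pdy m))).sub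
    (sum fun l => (hW m l).mul (((hG l).pdy k).pdy m))

lemma bweyl (k : Fin n) :
    Represents hU (fun x y => _root_.hD G (Ricci G) k x y
      - (1 / 2) * ∑ m, covD1 G (fun j => _root_.pdy (Ricci G) j) k m x y * y m)
      ((slitCalculus hU).bweyl Γ k) :=
  (hD hG (ricci hG) k).sub ((const (1 / 2)).mul (sum fun m => ((hD hG ((ricci hG).pdy k) m).sub
    (sum fun l => ((ricci hG).pdy l).mul (((hG l).pdy k).pdy m))).mul (coord m)))

lemma scurv {σ : Vec n → ℝ} {L : smoothOn (slitDomain hU)}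
    (hL : Represents hU (fun x _ => Real.log (σ x)) L) :
    Represents hU (Scurv G σ) ((slitCalculus hU).scurv Γ L) :=
  (sum fun m => (hG m).pdy m).sub (sum fun m => (coord m).mul (hL.pdx m))

lemma projSpray {σ : Vec n → ℝ} {L : smoothOn (slitDomain hU)}
    (hL : Represents hU (fun x _ => Real.log (σ x)) L) (i : Fin n) :
    Represents hU (Ghat G σ i) ((slitCalculus hU).projSpray Γ L i) :=
  (hG i).sub (((scurv hG hL).div_const _).mul (coord i))

end Spray

end Represents

lemma exists_represents {f : Vec n → Vec n → ℝ}
    (hf : ContDiffOn ℝ (⊤ : ℕ∞) (fun p : Vec n × Vec n => f p.1 p.2) (U ×ˢ slit n)) :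
    ∃ a, Represents hU f a :=
  ⟨⟨fun p => f p.1.1 p.1.2, _, hf, fun _ => rfl⟩, fun _ => rfl⟩

/-- Euler's identity for a spray. -/
lemma euler_of_represents {G : Fin n → Vec n → Vec n → ℝ} (hG : IsSpray U G) {i : Fin n}
    {a : smoothOn (slitDomain hU)} (ha : Represents hU (G i) a) :
    (slitCalculus hU).euler a = 2 * a := by
  ext p
  obtain ⟨⟨x, y⟩, hx, hy⟩ := p
  have hrep : Represents hU (fun x y => ∑ j, y j * pdy (G i) j x y)
      ((slitCalculus hU).euler a) := by
    rw [SlitCalculus.euler_apply]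
    exact .sum fun j => (Represents.coord j).mul (ha.pdy j)
  have h1 := hrep ⟨⟨x, y⟩, hx, hy⟩
  have h2 := (Represents.two.mul ha) ⟨⟨x, y⟩, hx, hy⟩
  rw [← h1, ← h2]
  have hd : DifferentiableAt ℝ (G i x) y := by
    have h := smoothOn.differentiableAt (f := fun q : Vec n × Vec n => G i q.1 q.2) ha
      ⟨⟨x, y⟩, hx, hy⟩
    exact h.comp (f := fun y => (x, y)) y (by fun_prop)
  have hlin : ∑ j, y j * pdy (G i) j x y = fderiv ℝ (G i x) y y := by
    conv_rhs => rw [pi_eq_sum_univ' y, map_sum]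
    refine Finset.sum_congr rfl fun j _ => ?_
    rw [map_smul, smul_eq_mul, pdy]
    congr 3
    funext l
    simp [Pi.single_apply]
  have hc : HasDerivAt (fun c : ℝ => G i x (c • y)) (fderiv ℝ (G i x) y y) 1 := by
    have hs : HasDerivAt (fun c : ℝ => c • y) y 1 := by
      simpa using (hasDerivAt_id (1 : ℝ)).smul_const y
    have hd' : HasFDerivAt (G i x) (fderiv ℝ (G i x) y) ((1 : ℝ) • y) := by
      simpa using hd.hasFDerivAt
    exact hd'.comp_hasDerivAt (1 : ℝ) hs
  have hc' : HasDerivAt (fun c : ℝ => G i x (c • y)) (2 * G i x y) 1 := by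
    have h : HasDerivAt (fun c : ℝ => c ^ 2 * G i x y) (2 * G i x y) 1 := by
      simpa using (hasDerivAt_pow 2 (1 : ℝ)).mul_const (G i x y)
    refine h.congr_of_eventuallyEq ?_
    filter_upwards [lt_mem_nhds (zero_lt_one' ℝ)] with c hc0
    exact hG.2 i x hx y hy c hc0
  exact hlin.trans (hc.unique hc')

end Slit

/-- Proposition 1.1: for `n ≥ 3`, `W^o_k = (1/(n-2)) W^m_{k∥m}`, the covariant derivative
`∥` being taken with respect to the projective spray `Ĝ` of `(G,dV)`. -/
theorem stmt_1 {n : ℕ} (hn : 3 ≤ n) (U : Set (Vec n)) (hU : IsOpen U) (hUne : U.Nonempty)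
    (G : Fin n → Vec n → Vec n → ℝ) (hG : IsSpray U G)
    (σ : Vec n → ℝ) (hσ : IsVolumeForm U σ) :
    ∀ x ∈ U, ∀ y ∈ slit n, ∀ k : Fin n,
      BWeyl G σ k x y = (1/((n : ℝ) - 2)) * ∑ m, covD11 (Ghat G σ) (Weyl G) m k m x y := by
  intro x hx y hy k
  choose Γ hΓ using fun i => exists_represents hU (hG.1 i)
  obtain ⟨L, hL⟩ := exists_represents hU (f := fun x _ => Real.log (σ x))
    ((hσ.1.log fun x hx => (hσ.2 x hx).ne').comp contDiffOn_fst fun p hp => hp.1)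
  have hYL : ∀ j, (slitCalculus hU).Y j L = 0 := fun j => by
    ext p
    rw [← hL.pdy j p]
    simp [pdy]
  have hn3 : (3 : ℝ) ≤ n := by exact_mod_cast hn
  have main := (slitCalculus hU).divergence_weyl_projSpray Γ
    (fun i => euler_of_represents hU hG (hΓ i)) (by linarith) hYL k
  have hĜ := Represents.projSpray hΓ hL
  have hdiv := Represents.divergence hĜ (Represents.weyl hΓ) k ⟨⟨x, y⟩, hx, hy⟩
  have hbw := Represents.bweyl hĜ k ⟨⟨x, y⟩, hx, hy⟩
  have heval := congrFun (congrArg Subtype.val main) ⟨⟨x, y⟩, hx, hy⟩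
  rw [← hdiv] at heval
  have heval' : ∑ m, covD11 (Ghat G σ) (Weyl G) m k m x y
      = ((n : ℝ) - 2) * BWeyl G σ k x y := heval.trans (congrArg (((n : ℝ) - 2) * ·) hbw.symm)
  have hn2 : (n : ℝ) - 2 ≠ 0 := by linarith
  rw [heval', ← mul_assoc, one_div, inv_mul_cancel₀ hn2, one_mul]

end BerwaldWeyl
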